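/- For all integers n ≥ k ≥ 1, the variance of the linear crossing number over partitions of [n] into k blocks satisfies Var(X_{n,k}) = (1/12)·(k²−1)·n − (1/72)·k·(k−1)·(2k+5) + (1/12)·(−15n² + (56k−43)n − 2(k−1)(14k−1))·S(n,k−1)/S(n,k) + (1/12)·(n−k+2)·(27n−27k+1)·S(n,k−2)/S(n,k) − (9/4)·(n+1−k)²·(S(n,k−1)/S(n,k))². -/

import Mathlib

open Finset

/-- Two elements lie in the same block of the set partition `π` of `[n]`. -/
def sameBlock {n : ℕ} (π : Finpartition (univ : Finset (Fin n))) (a b : Fin n) : Prop :=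
  ∃ B ∈ π.parts, a ∈ B ∧ b ∈ B

/-- `(a, b)` is an arc of `π`: `a < b`, they lie in a common block, and no element of that
block lies strictly between them. -/
def IsArc {n : ℕ} (π : Finpartition (univ : Finset (Fin n))) (a b : Fin n) : Prop :=
  a < b ∧ sameBlock π a b ∧ ∀ c : Fin n, a < c → c < b → ¬ sameBlock π a c

/-- The linear crossing number `cr^ℓ(π)`: the number of pairs of arcs
`((a,b),(c,d))` with `a < c < b < d`. -/
noncomputable def crl {n : ℕ} (π : Finpartition (univ : Finset (Fin n))) : ℕ :=
  Set.ncard {q : (Fin n × Fin n) × (Fin n × Fin n) |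
    IsArc π q.1.1 q.1.2 ∧ IsArc π q.2.1 q.2.2 ∧
    q.1.1 < q.2.1 ∧ q.2.1 < q.1.2 ∧ q.1.2 < q.2.2}

/-- `(a, b)` is a chord of `π`: `a < b` lie in a common block `B`, and either they are
consecutive elements of `B`, or `B` has at least 3 elements and `a = min B`, `b = max B`. -/
def IsChord {n : ℕ} (π : Finpartition (univ : Finset (Fin n))) (a b : Fin n) : Prop :=
  a < b ∧ ∃ B ∈ π.parts, a ∈ B ∧ b ∈ B ∧
    ((∀ c ∈ B, ¬(a < c ∧ c < b)) ∨ (3 ≤ B.card ∧ ∀ c ∈ B, a ≤ c ∧ c ≤ b))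

/-- The circular crossing number `cr^c(π)`: the number of unordered pairs of crossing chords,
counted as ordered pairs `((a,b),(c,d))` of chords with `a < c < b < d`. -/
noncomputable def crc {n : ℕ} (π : Finpartition (univ : Finset (Fin n))) : ℕ :=
  Set.ncard {q : (Fin n × Fin n) × (Fin n × Fin n) |
    IsChord π q.1.1 q.1.2 ∧ IsChord π q.2.1 q.2.2 ∧
    q.1.1 < q.2.1 ∧ q.2.1 < q.1.2 ∧ q.1.2 < q.2.2}

/-- The Stirling number of the second kind `S(n,k)`: the number of set partitions of `[n]`
into exactly `k` blocks. -/
noncomputable def stirling (n k : ℕ) : ℕ :=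
  Nat.card {π : Finpartition (univ : Finset (Fin n)) // π.parts.card = k}

/-- Stirling numbers with integer arguments: `S(m,j) = 0` unless `0 ≤ j ≤ m`. -/
noncomputable def stirlingZ (m j : ℤ) : ℕ :=
  if 0 ≤ m ∧ 0 ≤ j then stirling m.toNat j.toNat else 0

/-- The Bell number `B_n`: the number of set partitions of `[n]`. -/
noncomputable def bell (n : ℕ) : ℕ :=
  Nat.card (Finpartition (univ : Finset (Fin n)))

/-- The set partitions of `[n]` with exactly `k` blocks, as a `Finset`. -/
def Pik (n k : ℕ) : Finset (Finpartition (univ : Finset (Fin n))) :=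
  Finset.univ.filter fun π => π.parts.card = k

/-- The mean of the linear crossing number over `Π_n^k`. -/
noncomputable def EX (n k : ℕ) : ℝ :=
  (∑ π ∈ Pik n k, (crl π : ℝ)) / stirling n k

/-- The variance of the linear crossing number over `Π_n^k`. -/
noncomputable def VarX (n k : ℕ) : ℝ :=
  (∑ π ∈ Pik n k, (crl π : ℝ) ^ 2) / stirling n k - EX n k ^ 2

/-- The mean of the circular crossing number over `Π_n^k`. -/
noncomputable def EY (n k : ℕ) : ℝ :=
  (∑ π ∈ Pik n k, (crc π : ℝ)) / stirling n k

/-- The variance of the circular crossing number over `Π_n^k`. -/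
noncomputable def VarY (n k : ℕ) : ℝ :=
  (∑ π ∈ Pik n k, (crc π : ℝ) ^ 2) / stirling n k - EY n k ^ 2

/-- The mean of the linear crossing number over all of `Π_n`. -/
noncomputable def EXall (n : ℕ) : ℝ :=
  (∑ π : Finpartition (univ : Finset (Fin n)), (crl π : ℝ)) / bell n

/-- The variance of the linear crossing number over all of `Π_n`. -/
noncomputable def VarXall (n : ℕ) : ℝ :=
  (∑ π : Finpartition (univ : Finset (Fin n)), (crl π : ℝ) ^ 2) / bell n - EXall n ^ 2

/-- The mean of the circular crossing number over all of `Π_n`. -/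
noncomputable def EYall (n : ℕ) : ℝ :=
  (∑ π : Finpartition (univ : Finset (Fin n)), (crc π : ℝ)) / bell n

/-- The variance of the circular crossing number over all of `Π_n`. -/
noncomputable def VarYall (n : ℕ) : ℝ :=
  (∑ π : Finpartition (univ : Finset (Fin n)), (crc π : ℝ) ^ 2) / bell n - EYall n ^ 2

/-- The standard normal distribution function `Φ`. -/
noncomputable def stdNormalCDF (x : ℝ) : ℝ :=
  (Real.sqrt (2 * Real.pi))⁻¹ * ∫ t in Set.Iic x, Real.exp (-t ^ 2 / 2)

/-! ### Arc diagrams -/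

/-- A set of arcs on `{0, …, n - 1}` in which every vertex is the left end of at most one arc and
the right end of at most one arc. -/
def IsArcDiagram (n : ℕ) (R : Finset (ℕ × ℕ)) : Prop :=
  (∀ p ∈ R, p.1 < p.2 ∧ p.2 < n) ∧ (∀ p ∈ R, ∀ q ∈ R, p.1 = q.1 → p = q) ∧
    ∀ p ∈ R, ∀ q ∈ R, p.2 = q.2 → p = q

open Classical in
/-- The finite set of all arc diagrams on `{0, …, n - 1}`. -/
noncomputable def arcDiagrams (n : ℕ) : Finset (Finset (ℕ × ℕ)) :=
  (range n ×ˢ range n).powerset.filter (IsArcDiagram n)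

/-- The vertices that are not the left end of an arc. -/
def freeLeft (n : ℕ) (R : Finset (ℕ × ℕ)) : Finset ℕ :=
  (range n).filter fun a => ∀ p ∈ R, p.1 ≠ a

/-- The number of arcs passing over the vertex `c`. -/
def covers (R : Finset (ℕ × ℕ)) (c : ℕ) : ℕ := #{p ∈ R | p.1 < c ∧ c < p.2}

/-- The number of crossings of a set of arcs. -/
def crossings (R : Finset (ℕ × ℕ)) : ℕ :=
  ∑ q ∈ R, #{p ∈ R | p.1 < q.1 ∧ q.1 < p.2 ∧ p.2 < q.2}

/-- The number of crossings when, in addition, an infinite half-arc leaves each vertex of `O`. -/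
def openCrossings (R : Finset (ℕ × ℕ)) (O : Finset ℕ) : ℕ :=
  crossings R + ∑ c ∈ O, covers R c

lemma mem_arcDiagrams {n : ℕ} {R : Finset (ℕ × ℕ)} : R ∈ arcDiagrams n ↔ IsArcDiagram n R := by
  simp only [arcDiagrams, mem_filter, mem_powerset, and_iff_right_iff_imp]
  intro h p hp
  have := h.1 p hp
  simp only [mem_product, mem_range]
  omega

lemma arcDiagrams_zero : arcDiagrams 0 = {∅} := by
  ext R
  simp only [mem_arcDiagrams, mem_singleton]
  constructor
  · intro h
    refine eq_empty_of_forall_notMem fun p hp => ?_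
    have := h.1 p hp
    omega
  · rintro rfl
    simp [IsArcDiagram]

lemma mem_freeLeft {n a : ℕ} {R : Finset (ℕ × ℕ)} :
    a ∈ freeLeft n R ↔ a < n ∧ ∀ p ∈ R, p.1 ≠ a := by
  simp [freeLeft]

lemma IsArcDiagram.succ {n : ℕ} {R : Finset (ℕ × ℕ)} (h : IsArcDiagram n R) :
    IsArcDiagram (n + 1) R :=
  ⟨fun p hp => ⟨(h.1 p hp).1, (h.1 p hp).2.trans n.lt_succ_self⟩, h.2⟩

lemma IsArcDiagram.insert_arc {n a : ℕ} {R : Finset (ℕ × ℕ)} (h : IsArcDiagram n R)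
    (ha : a ∈ freeLeft n R) : IsArcDiagram (n + 1) (insert (a, n) R) := by
  rw [mem_freeLeft] at ha
  obtain ⟨h1, h2, h3⟩ := h
  refine ⟨fun p hp => ?_, fun p hp q hq e => ?_, fun p hp q hq e => ?_⟩
  · rcases mem_insert.1 hp with rfl | hp
    · exact ⟨ha.1, n.lt_succ_self⟩
    · have := h1 p hp
      omega
  · rcases mem_insert.1 hp with rfl | hp' <;> rcases mem_insert.1 hq with rfl | hq'
    · rfl
    · exact absurd e.symm (ha.2 q hq')
    · exact absurd e (ha.2 p hp')
    · exact h2 p hp' q hq' e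
  · rcases mem_insert.1 hp with rfl | hp' <;> rcases mem_insert.1 hq with rfl | hq'
    · rfl
    · have := h1 q hq'
      simp only at e
      omega
    · have := h1 p hp'
      simp only at e
      omega
    · exact h3 p hp' q hq' e

lemma IsArcDiagram.notMem {n : ℕ} {R : Finset (ℕ × ℕ)} (h : IsArcDiagram n R) (a : ℕ) :
    (a, n) ∉ R := fun ha => (h.1 _ ha).2.false

lemma IsArcDiagram.of_succ {n : ℕ} {R : Finset (ℕ × ℕ)} (h : IsArcDiagram (n + 1) R)
    (hn : ∀ a, (a, n) ∉ R) : IsArcDiagram n R := by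
  refine ⟨fun p hp => ⟨(h.1 p hp).1, ?_⟩, h.2⟩
  refine lt_of_le_of_ne (Nat.lt_succ_iff.1 (h.1 p hp).2) ?_
  rintro e
  exact hn p.1 (by rw [← e]; exact hp)

lemma IsArcDiagram.erase_arc {n a : ℕ} {R : Finset (ℕ × ℕ)} (h : IsArcDiagram (n + 1) R)
    (ha : (a, n) ∈ R) : IsArcDiagram n (R.erase (a, n)) ∧ a ∈ freeLeft n (R.erase (a, n)) := by
  obtain ⟨h1, h2, h3⟩ := h
  refine ⟨⟨fun p hp => ?_, fun p hp q hq e => ?_, fun p hp q hq e => ?_⟩, ?_⟩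
  · have hp' := mem_erase.1 hp
    have h4 := h1 p hp'.2
    refine ⟨h4.1, lt_of_le_of_ne (Nat.lt_succ_iff.1 h4.2) fun e => hp'.1 ?_⟩
    exact h3 _ hp'.2 _ ha e
  · exact h2 p (mem_of_mem_erase hp) q (mem_of_mem_erase hq) e
  · exact h3 p (mem_of_mem_erase hp) q (mem_of_mem_erase hq) e
  · refine mem_freeLeft.2 ⟨(h1 _ ha).1, fun p hp e => (mem_erase.1 hp).1 ?_⟩
    exact h2 _ (mem_of_mem_erase hp) _ ha e

/-- Every arc diagram on `n + 1` vertices arises uniquely from one on `n` vertices, by letting the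
new vertex be the right end of no arc or of an arc from a free vertex. -/
lemma sum_arcDiagrams_succ (n : ℕ) (g : Finset (ℕ × ℕ) → ℝ) :
    ∑ R ∈ arcDiagrams (n + 1), g R =
      ∑ R ∈ arcDiagrams n, (g R + ∑ a ∈ freeLeft n R, g (insert (a, n) R)) := by
  classical
  rw [← sum_filter_not_add_sum_filter _ (fun R => ∃ a, (a, n) ∈ R), sum_add_distrib]
  congr 1
  · refine sum_congr ?_ fun _ _ => rfl
    ext R
    simp only [mem_filter, mem_arcDiagrams, not_exists]
    exact ⟨fun h => h.1.of_succ h.2, fun h => ⟨h.succ, h.notMem⟩⟩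
  · rw [sum_sigma']
    symm
    refine sum_bij (fun x _ => insert (x.2, n) x.1) ?_ ?_ ?_ fun _ _ => rfl
    · rintro ⟨R, a⟩ h
      simp only [mem_sigma, mem_arcDiagrams] at h
      simp only [mem_filter, mem_arcDiagrams]
      exact ⟨h.1.insert_arc h.2, a, mem_insert_self _ _⟩
    · rintro ⟨R, a⟩ h ⟨R', a'⟩ h' e
      simp only [mem_sigma, mem_arcDiagrams] at h h'
      simp only at e
      have haa : a = a' := by
        have : (a, n) ∈ insert (a', n) R' := e ▸ mem_insert_self _ _
        rcases mem_insert.1 this with h4 | h4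
        · exact congrArg Prod.fst h4
        · exact absurd h4 (h'.1.notMem a)
      subst haa
      have : R = R' := by
        rw [← erase_insert (h.1.notMem a), e, erase_insert (h'.1.notMem a)]
      rw [this]
    · intro R h
      simp only [mem_filter, mem_arcDiagrams] at h
      obtain ⟨h1, a, ha⟩ := h
      refine ⟨⟨R.erase (a, n), a⟩, ?_, insert_erase ha⟩
      simp only [mem_sigma, mem_arcDiagrams]
      exact h1.erase_arc ha

lemma IsArcDiagram.freeLeft_succ {n : ℕ} {R : Finset (ℕ × ℕ)} (h : IsArcDiagram n R) :
    freeLeft (n + 1) R = insert n (freeLeft n R) := by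
  ext c
  simp only [mem_insert, mem_freeLeft]
  constructor
  · rintro ⟨h1, h2⟩
    by_cases hc : c = n
    · exact Or.inl hc
    · exact Or.inr ⟨by omega, h2⟩
  · rintro (rfl | ⟨h1, h2⟩)
    · refine ⟨by omega, fun p hp => ?_⟩
      have := h.1 p hp
      omega
    · exact ⟨by omega, h2⟩

lemma IsArcDiagram.freeLeft_insert {n a : ℕ} {R : Finset (ℕ × ℕ)} (h : IsArcDiagram n R)
    (ha : a ∈ freeLeft n R) :
    freeLeft (n + 1) (insert (a, n) R) = insert n ((freeLeft n R).erase a) := by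
  have h' := h.freeLeft_succ
  have ha' := (mem_freeLeft.1 ha).1
  ext c
  have hc := Finset.ext_iff.1 h' c
  simp only [mem_insert, mem_freeLeft, mem_erase, forall_eq_or_imp] at hc ⊢
  constructor
  · rintro ⟨h1, h2, h3⟩
    rcases hc.1 ⟨h1, h3⟩ with h4 | h4
    · exact Or.inl h4
    · exact Or.inr ⟨Ne.symm h2, h4⟩
  · rintro (rfl | ⟨h1, h2⟩)
    · have := hc.2 (Or.inl rfl)
      exact ⟨this.1, by omega, this.2⟩
    · have := hc.2 (Or.inr h2)
      exact ⟨this.1, Ne.symm h1, this.2⟩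

lemma notMem_freeLeft_self (n : ℕ) (R : Finset (ℕ × ℕ)) : n ∉ freeLeft n R := by
  simp [mem_freeLeft]

lemma IsArcDiagram.covers_self {n : ℕ} {R : Finset (ℕ × ℕ)} (h : IsArcDiagram n R) :
    covers R n = 0 := by
  rw [covers, card_eq_zero, filter_eq_empty_iff]
  intro p hp
  have := h.1 p hp
  omega

lemma IsArcDiagram.openCrossings_insert_vertex {n : ℕ} {R : Finset (ℕ × ℕ)}
    (h : IsArcDiagram n R) {O : Finset ℕ} (hO : n ∉ O) :
    openCrossings R (insert n O) = openCrossings R O := by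
  rw [openCrossings, openCrossings, sum_insert hO, h.covers_self, zero_add]

lemma IsArcDiagram.crossings_insert {n a : ℕ} {R : Finset (ℕ × ℕ)} (h : IsArcDiagram n R) :
    crossings (insert (a, n) R) = crossings R + covers R a := by
  rw [crossings, sum_insert (h.notMem a), add_comm]
  congr 1
  · refine sum_congr rfl fun q hq => ?_
    have := h.1 q hq
    rw [filter_insert, if_neg]
    simp only
    omega
  · rw [filter_insert, if_neg (by simp), covers]
    congr 1
    refine filter_congr fun p hp => ?_
    have := h.1 p hp
    simp only
    omega

lemma IsArcDiagram.covers_insert {n a c : ℕ} {R : Finset (ℕ × ℕ)} (h : IsArcDiagram n R)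
    (hc : c < n) :
    covers (insert (a, n) R) c = covers R c + if a < c then 1 else 0 := by
  rw [covers, filter_insert, covers]
  simp only [hc, and_true]
  split_ifs with hac
  · rw [card_insert_of_notMem]
    exact fun hm => h.notMem a (mem_filter.1 hm).1
  · rfl

lemma IsArcDiagram.openCrossings_insert {n a : ℕ} {R : Finset (ℕ × ℕ)} (h : IsArcDiagram n R)
    {O : Finset ℕ} (hO : O ⊆ freeLeft n R) (ha : a ∈ O) :
    openCrossings (insert (a, n) R) (O.erase a) =
      openCrossings R O + #{c ∈ O | a < c} := by
  have hs : ∑ c ∈ O.erase a, covers (insert (a, n) R) c =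
      ∑ c ∈ O.erase a, covers R c + #{c ∈ O | a < c} := by
    rw [sum_congr rfl fun c hc => h.covers_insert (mem_freeLeft.1 (hO (mem_of_mem_erase hc))).1,
      sum_add_distrib, ← card_filter]
    congr 2
    ext c
    simp only [mem_filter, mem_erase]
    constructor
    · rintro ⟨⟨_, h1⟩, h2⟩
      exact ⟨h1, h2⟩
    · rintro ⟨h1, h2⟩
      exact ⟨⟨by omega, h1⟩, h2⟩
  rw [openCrossings, openCrossings, h.crossings_insert, hs, ← add_sum_erase O _ ha]
  ring

lemma sum_card_filter_lt (O : Finset ℕ) (f : ℕ → ℝ) :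
    ∑ a ∈ O, f #{c ∈ O | a < c} = ∑ i ∈ range #O, f i := by
  induction O using Finset.induction_on_min with
  | empty => simp
  | insert a s hs ih =>
    have ha : a ∉ s := fun h => (hs a h).false
    rw [sum_insert ha, card_insert_of_notMem ha, sum_range_succ, ← ih, add_comm]
    congr 1
    · refine sum_congr rfl fun b hb => ?_
      rw [filter_insert, if_neg (hs b hb).not_gt]
    · rw [filter_insert, if_neg (lt_irrefl a), filter_true_of_mem hs]

lemma sum_powerset_erase (F : Finset ℕ) (g : ℕ → Finset ℕ → ℝ) :
    ∑ a ∈ F, ∑ O ∈ (F.erase a).powerset, g a O =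
      ∑ O ∈ F.powerset, ∑ a ∈ O, g a (O.erase a) := by
  rw [sum_sigma', sum_sigma']
  refine sum_bij' (fun x _ => ⟨insert x.1 x.2, x.1⟩) (fun x _ => ⟨x.2, x.1.erase x.2⟩)
    ?_ ?_ ?_ ?_ ?_
  · rintro ⟨a, O⟩ h
    simp only [mem_sigma, mem_powerset] at h ⊢
    exact ⟨insert_subset h.1 (h.2.trans (erase_subset _ _)), mem_insert_self _ _⟩
  · rintro ⟨O, a⟩ h
    simp only [mem_sigma, mem_powerset] at h ⊢
    exact ⟨h.1 h.2, erase_subset_erase _ h.1⟩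
  · rintro ⟨a, O⟩ h
    simp only [mem_sigma, mem_powerset] at h
    simp only [erase_insert fun ha => (mem_erase.1 (h.2 ha)).1 rfl]
  · rintro ⟨O, a⟩ h
    simp only [mem_sigma, mem_powerset] at h
    simp only [insert_erase h.2]
  · rintro ⟨a, O⟩ h
    simp only [mem_sigma, mem_powerset] at h
    simp only [erase_insert fun ha => (mem_erase.1 (h.2 ha)).1 rfl]

/-- The sum of `φ (number of arcs) (number of half-arcs) (number of crossings)` over all arc
diagrams on `n` vertices with half-arcs leaving some of the free vertices. -/
noncomputable def openSum (n : ℕ) (φ : ℕ → ℕ → ℕ → ℝ) : ℝ :=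
  ∑ R ∈ arcDiagrams n, ∑ O ∈ (freeLeft n R).powerset, φ #R #O (openCrossings R O)

lemma openSum_zero (φ : ℕ → ℕ → ℕ → ℝ) : openSum 0 φ = φ 0 0 0 := by
  simp [openSum, arcDiagrams_zero, freeLeft, openCrossings, crossings]

lemma openSum_add (n : ℕ) (φ ψ : ℕ → ℕ → ℕ → ℝ) :
    openSum n (fun r h w => φ r h w + ψ r h w) = openSum n φ + openSum n ψ := by
  simp only [openSum, sum_add_distrib]

lemma openSum_const_mul (n : ℕ) (c : ℝ) (φ : ℕ → ℕ → ℕ → ℝ) :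
    openSum n (fun r h w => c * φ r h w) = c * openSum n φ := by
  simp only [openSum, mul_sum]

/-- The transfer recursion: a new vertex either closes no half-arc or one of the `h` present,
creating `0`, …, `h - 1` crossings, and it may open a new half-arc. -/
lemma openSum_succ (n : ℕ) (φ : ℕ → ℕ → ℕ → ℝ) :
    openSum (n + 1) φ = openSum n fun r h w => φ r h w + φ r (h + 1) w +
      ∑ i ∈ range h, (φ (r + 1) (h - 1) (w + i) + φ (r + 1) h (w + i)) := by
  rw [openSum, sum_arcDiagrams_succ, openSum]
  refine sum_congr rfl fun R hR => ?_
  have h := mem_arcDiagrams.1 hR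
  have hn := notMem_freeLeft_self n R
  rw [sum_add_distrib]
  congr 1
  · rw [h.freeLeft_succ, sum_powerset_insert hn, ← sum_add_distrib]
    refine sum_congr rfl fun O hO => ?_
    have hO' : n ∉ O := fun hm => hn (mem_powerset.1 hO hm)
    rw [h.openCrossings_insert_vertex hO', card_insert_of_notMem hO']
  · have key : ∀ a ∈ freeLeft n R,
        ∑ O ∈ (freeLeft (n + 1) (insert (a, n) R)).powerset,
          φ #(insert (a, n) R) #O (openCrossings (insert (a, n) R) O) =
        ∑ O ∈ ((freeLeft n R).erase a).powerset,
          (φ (#R + 1) #O (openCrossings (insert (a, n) R) O) +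
            φ (#R + 1) (#O + 1) (openCrossings (insert (a, n) R) O)) := by
      intro a ha
      have hne : n ∉ (freeLeft n R).erase a := fun hm => hn (mem_of_mem_erase hm)
      rw [h.freeLeft_insert ha, sum_powerset_insert hne, ← sum_add_distrib,
        card_insert_of_notMem (h.notMem a)]
      refine sum_congr rfl fun O hO => ?_
      have hO' : n ∉ O := fun hm => hne (mem_powerset.1 hO hm)
      have hcov : covers (insert (a, n) R) n = 0 := (h.insert_arc ha).1 |> fun h1 => by
        rw [covers, card_eq_zero, filter_eq_empty_iff]
        intro p hp
        have := h1 p hp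
        omega
      rw [card_insert_of_notMem hO', openCrossings, openCrossings, sum_insert hO', hcov, zero_add]
    rw [sum_congr rfl key, sum_powerset_erase _ fun a O =>
      φ (#R + 1) #O (openCrossings (insert (a, n) R) O) +
        φ (#R + 1) (#O + 1) (openCrossings (insert (a, n) R) O)]
    refine sum_congr rfl fun O hO => ?_
    rw [← sum_card_filter_lt]
    refine sum_congr rfl fun a ha => ?_
    have hpos : #O - 1 + 1 = #O := Nat.sub_add_cancel (card_pos.2 ⟨a, ha⟩)
    rw [h.openCrossings_insert (mem_powerset.1 hO) ha, card_erase_of_mem ha, hpos]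

/-! ### Moments of the number of crossings with a given number of blocks and half-arcs -/

/-- The number of crossings to the power `j`, restricted to diagrams with `K` blocks and `H`
half-arcs. -/
noncomputable def blockPow (n : ℕ) (K H : ℤ) (j : ℕ) (r h w : ℕ) : ℝ :=
  if (n : ℤ) - r = K ∧ (h : ℤ) = H then (w : ℝ) ^ j else 0

/-- The `j`-th moment (not normalized) of the number of crossings over diagrams on `n` vertices
with `K` blocks and `H` half-arcs. -/
noncomputable def openMoment (n : ℕ) (K H : ℤ) (j : ℕ) : ℝ :=
  openSum n (blockPow n K H j)

/-- The effect of the transfer recursion on the `j`-th power. -/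
lemma blockPow_succ (n : ℕ) (K H : ℤ) (j r h w : ℕ) (Q : ℝ → ℝ) (hQ0 : Q 0 = 0)
    (hQ : ∀ m : ℕ, ∑ i ∈ range m, ((w + i : ℕ) : ℝ) ^ j = Q m) :
    blockPow (n + 1) K H j r h w + blockPow (n + 1) K H j r (h + 1) w +
      ∑ i ∈ range h, (blockPow (n + 1) K H j (r + 1) (h - 1) (w + i) +
        blockPow (n + 1) K H j (r + 1) h (w + i)) =
    blockPow n (K - 1) H j r h w + blockPow n (K - 1) (H - 1) j r h w +
      (Q (H + 1) * blockPow n K (H + 1) 0 r h w + Q H * blockPow n K H 0 r h w) := by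
  have e1 : ∀ x y : ℤ, (((n + 1 : ℕ) : ℤ) - r = K ∧ x = y) ↔ ((n : ℤ) - r = K - 1 ∧ x = y) := by
    intro x y
    push_cast
    constructor <;> rintro ⟨h1, h2⟩ <;> exact ⟨by omega, h2⟩
  have e2 : ∀ x y : ℤ, (((n + 1 : ℕ) : ℤ) - (r + 1 : ℕ) = K ∧ x = y) ↔
      ((n : ℤ) - r = K ∧ x = y) := by
    intro x y
    push_cast
    constructor <;> rintro ⟨h1, h2⟩ <;> exact ⟨by omega, h2⟩
  have e3 : (((h + 1 : ℕ) : ℤ) = H) ↔ ((h : ℤ) = H - 1) := by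
    push_cast
    omega
  have hsum : ∀ P : Prop, [Decidable P] →
      ∑ i ∈ range h, (if P then ((w + i : ℕ) : ℝ) ^ j else 0) = if P then Q h else 0 := by
    intro P _
    split_ifs
    · exact hQ h
    · simp
  simp only [blockPow, e1, e2, e3, sum_add_distrib, hsum, pow_zero, mul_ite, mul_one, mul_zero]
  congr 2
  · rcases Nat.eq_zero_or_pos h with rfl | hh
    · have : ∀ P : Prop, [Decidable P] → (if P then Q ((0 : ℕ) : ℝ) else 0) = 0 := by
        intro P _
        split_ifs <;> simp [hQ0]
      rw [this]
      split_ifs with hc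
      · have : (H : ℝ) + 1 = 0 := by exact_mod_cast hc.2.symm
        rw [this, hQ0]
      · rfl
    · have e4 : (((h - 1 : ℕ) : ℤ) = H) ↔ ((h : ℤ) = H + 1) := by omega
      simp only [e4]
      split_ifs with hc
      · have : (H : ℝ) + 1 = h := by exact_mod_cast hc.2.symm
        rw [this]
      · rfl
  · split_ifs with hc
    · have : (H : ℝ) = h := by exact_mod_cast hc.2.symm
      rw [this]
    · rfl

lemma blockPow_eq_mul (n : ℕ) (K H : ℤ) (j r h w : ℕ) :
    blockPow n K H j r h w = (w : ℝ) ^ j * blockPow n K H 0 r h w := by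
  simp [blockPow]

lemma openMoment_zero_succ (n : ℕ) (K H : ℤ) :
    openMoment (n + 1) K H 0 = openMoment n (K - 1) H 0 + openMoment n (K - 1) (H - 1) 0 +
      ((H + 1) * openMoment n K (H + 1) 0 + H * openMoment n K H 0) := by
  simp only [openMoment, ← openSum_add, ← openSum_const_mul]
  rw [openSum_succ]
  congr 1
  funext r h w
  exact blockPow_succ n K H 0 r h w (fun x => x) rfl (by simp)

lemma openMoment_one_succ (n : ℕ) (K H : ℤ) :
    openMoment (n + 1) K H 1 = openMoment n (K - 1) H 1 + openMoment n (K - 1) (H - 1) 1 +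
      ((H + 1) * openMoment n K (H + 1) 1 + H * openMoment n K H 1) +
      ((H + 1) * H / 2 * openMoment n K (H + 1) 0 + H * (H - 1) / 2 * openMoment n K H 0) := by
  simp only [openMoment, ← openSum_add, ← openSum_const_mul]
  rw [openSum_succ]
  congr 1
  funext r h w
  rw [blockPow_succ n K H 1 r h w (fun x => x * w + x * (x - 1) / 2) (by simp),
    blockPow_eq_mul n K (H + 1) 1, blockPow_eq_mul n K H 1]
  · ring
  · intro m
    induction m with
    | zero => simp
    | succ m ih =>
      rw [sum_range_succ, ih]
      push_cast
      ring

lemma openMoment_two_succ (n : ℕ) (K H : ℤ) :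
    openMoment (n + 1) K H 2 = openMoment n (K - 1) H 2 + openMoment n (K - 1) (H - 1) 2 +
      ((H + 1) * openMoment n K (H + 1) 2 + H * openMoment n K H 2) +
      ((H + 1) * H * openMoment n K (H + 1) 1 + H * (H - 1) * openMoment n K H 1) +
      (((H + 1) * H * (H - 1) / 3 + (H + 1) * H / 2) * openMoment n K (H + 1) 0 +
        (H * (H - 1) * (H - 2) / 3 + H * (H - 1) / 2) * openMoment n K H 0) := by
  simp only [openMoment, ← openSum_add, ← openSum_const_mul]
  rw [openSum_succ]
  congr 1
  funext r h w
  rw [blockPow_succ n K H 2 r h w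
      (fun x => x * w ^ 2 + x * (x - 1) * w + (x * (x - 1) * (x - 2) / 3 + x * (x - 1) / 2))
      (by simp),
    blockPow_eq_mul n K (H + 1) 2, blockPow_eq_mul n K H 2,
    blockPow_eq_mul n K (H + 1) 1, blockPow_eq_mul n K H 1]
  · ring
  · intro m
    induction m with
    | zero => simp
    | succ m ih =>
      rw [sum_range_succ, ih]
      push_cast
      ring

lemma openMoment_zero_left (K H : ℤ) (j : ℕ) :
    openMoment 0 K H j = if K = 0 ∧ H = 0 then (0 : ℝ) ^ j else 0 := by
  simp [openMoment, openSum_zero, blockPow, eq_comm]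

/-! ### Binomial coefficients and Stirling numbers with integer arguments -/

/-- Binomial coefficients, extended by zero to negative arguments. -/
noncomputable def intChoose (K H : ℤ) : ℝ :=
  if 0 ≤ K ∧ 0 ≤ H then (K.toNat.choose H.toNat : ℝ) else 0

lemma intChoose_of_neg {K : ℤ} (hK : K < 0) (H : ℤ) : intChoose K H = 0 :=
  if_neg fun h => by omega

lemma intChoose_of_neg_right (K : ℤ) {H : ℤ} (hH : H < 0) : intChoose K H = 0 :=
  if_neg fun h => by omega

lemma intChoose_natCast (k h : ℕ) : intChoose k h = k.choose h := by
  simp [intChoose]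

lemma intChoose_zero_right {K : ℤ} (hK : 0 ≤ K) : intChoose K 0 = 1 := by
  simp [intChoose, hK]

lemma intChoose_zero_left (H : ℤ) : intChoose 0 H = if H = 0 then 1 else 0 := by
  rcases lt_or_ge H 0 with hH | hH
  · rw [intChoose_of_neg_right _ hH, if_neg (by omega)]
  · lift H to ℕ using hH
    rw [show (0 : ℤ) = ((0 : ℕ) : ℤ) from rfl, intChoose_natCast]
    rcases H with _ | m
    · simp
    · simp only [Nat.choose_zero_succ, Nat.cast_zero]
      rw [if_neg (by omega)]

lemma intChoose_pascal {K : ℤ} (hK : 0 < K) (H : ℤ) :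
    intChoose (K - 1) H + intChoose (K - 1) (H - 1) = intChoose K H := by
  obtain ⟨k, rfl⟩ : ∃ k : ℕ, K = k + 1 := ⟨(K - 1).toNat, by omega⟩
  rw [add_sub_cancel_right]
  rcases lt_trichotomy H 0 with hH | rfl | hH
  · simp [intChoose_of_neg_right, hH, show H - 1 < 0 by omega]
  · rw [intChoose_of_neg_right _ (show (0 : ℤ) - 1 < 0 by omega),
      intChoose_zero_right (by omega), intChoose_zero_right (by omega), add_zero]
  · obtain ⟨h, rfl⟩ : ∃ h : ℕ, H = h + 1 := ⟨(H - 1).toNat, by omega⟩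
    rw [add_sub_cancel_right]
    have := Nat.choose_succ_succ k h
    have e := intChoose_natCast (k + 1) (h + 1)
    have e' := intChoose_natCast k (h + 1)
    push_cast at e e'
    rw [e, e', intChoose_natCast, Nat.choose_succ_succ]
    push_cast
    ring

lemma mul_intChoose (K H : ℤ) :
    (H : ℝ) * intChoose K H = K * intChoose (K - 1) (H - 1) := by
  rcases lt_trichotomy K 0 with hK | rfl | hK
  · simp [intChoose_of_neg, hK, show K - 1 < 0 by omega]
  · rw [intChoose_zero_left]
    split_ifs with h <;> simp [h]
  · obtain ⟨k, rfl⟩ : ∃ k : ℕ, K = k + 1 := ⟨(K - 1).toNat, by omega⟩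
    rw [add_sub_cancel_right]
    rcases lt_trichotomy H 0 with hH | rfl | hH
    · simp [intChoose_of_neg_right, hH, show H - 1 < 0 by omega]
    · rw [intChoose_of_neg_right _ (show (0 : ℤ) - 1 < 0 by omega)]
      simp
    · obtain ⟨h, rfl⟩ : ∃ h : ℕ, H = h + 1 := ⟨(H - 1).toNat, by omega⟩
      rw [add_sub_cancel_right]
      have e := intChoose_natCast (k + 1) (h + 1)
      push_cast at e
      rw [e, intChoose_natCast, mul_comm]
      exact_mod_cast (Nat.add_one_mul_choose_eq k h).symm

/-- The derivative of `u ^ K`, multiplied by `u = 1 + x`, in terms of coefficients of `x ^ H`. -/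
lemma intChoose_deriv (K H : ℤ) :
    (H + 1 : ℝ) * intChoose K (H + 1) + H * intChoose K H = K * intChoose K H := by
  have h1 := mul_intChoose K (H + 1)
  have h2 := mul_intChoose K H
  rw [add_sub_cancel_right] at h1
  push_cast at h1
  rcases lt_trichotomy K 0 with hK | rfl | hK
  · simp [intChoose_of_neg hK]
  · rw [h1, h2]
    simp
  · rw [h1, h2, ← mul_add, intChoose_pascal hK]

lemma mul_intChoose_eq_sub (K H : ℤ) :
    (H : ℝ) * intChoose K H = K * (intChoose K H - intChoose (K - 1) H) := by
  rw [mul_intChoose]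
  rcases lt_trichotomy K 0 with hK | rfl | hK
  · simp [intChoose_of_neg, hK, show K - 1 < 0 by omega]
  · simp
  · rw [← intChoose_pascal hK]
    ring

lemma intChoose_deriv_two (K H : ℤ) :
    (H + 1 : ℝ) * H * intChoose K (H + 1) + H * (H - 1) * intChoose K H =
      K * (K - 1) * (intChoose K H - intChoose (K - 1) H) := by
  linear_combination (H : ℝ) * intChoose_deriv K H + (K - 1 : ℝ) * mul_intChoose_eq_sub K H

lemma intChoose_deriv_three (K H : ℤ) :
    (H + 1 : ℝ) * H * (H - 1) * intChoose K (H + 1) + H * (H - 1) * (H - 2) * intChoose K H =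
      K * (K - 1) * (K - 2) *
        (intChoose K H - 2 * intChoose (K - 1) H + intChoose (K - 2) H) := by
  have h := mul_intChoose_eq_sub (K - 1) H
  rw [show K - 1 - 1 = K - 2 by ring] at h
  push_cast at h
  linear_combination (H : ℝ) * (H - 1) * intChoose_deriv K H +
    (K - 2 : ℝ) * (H - 1) * mul_intChoose_eq_sub K H +
    (K - 2 : ℝ) * K * mul_intChoose_eq_sub K H - (K - 2 : ℝ) * K * h

/-- Stirling numbers of the second kind, extended by zero to negative `K`. -/
noncomputable def intStirling : ℕ → ℤ → ℝ
  | 0, K => if K = 0 then 1 else 0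
  | n + 1, K => K * intStirling n K + intStirling n (K - 1)

lemma intStirling_succ (n : ℕ) (K : ℤ) :
    intStirling (n + 1) K = K * intStirling n K + intStirling n (K - 1) := rfl

lemma intStirling_of_neg (n : ℕ) : ∀ K : ℤ, K < 0 → intStirling n K = 0 := by
  induction n with
  | zero => exact fun K hK => if_neg hK.ne
  | succ n ih =>
    intro K hK
    rw [intStirling_succ, ih K hK, ih (K - 1) (by omega)]
    ring

lemma intStirling_nonneg (n : ℕ) (K : ℤ) : 0 ≤ intStirling n K := by
  rcases lt_or_ge K 0 with hK | hK
  · rw [intStirling_of_neg n K hK]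
  · induction n generalizing K with
    | zero =>
      rw [intStirling]
      split_ifs <;> norm_num
    | succ n ih =>
      rw [intStirling_succ]
      have h1 : (0 : ℝ) ≤ K := by exact_mod_cast hK
      have h2 : 0 ≤ intStirling n (K - 1) := by
        rcases lt_or_ge (K - 1) 0 with hK' | hK'
        · rw [intStirling_of_neg n _ hK']
        · exact ih _ hK'
      have := ih K hK
      positivity

lemma intStirling_self (n : ℕ) : 0 < intStirling n n := by
  induction n with
  | zero => simp [intStirling]
  | succ n ih =>
    rw [intStirling_succ]
    have h1 := intStirling_nonneg n ((n + 1 : ℕ) : ℤ)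
    rw [show ((n + 1 : ℕ) : ℤ) - 1 = n by push_cast; ring]
    have h2 : (0 : ℝ) ≤ (((n + 1 : ℕ) : ℤ) : ℝ) := by positivity
    nlinarith [mul_nonneg h2 h1]

lemma intStirling_pos {n k : ℕ} (hk : 1 ≤ k) (hkn : k ≤ n) : 0 < intStirling n k := by
  induction n, hkn using Nat.le_induction with
  | base => exact intStirling_self k
  | succ n _ ih =>
    rw [intStirling_succ]
    have h1 := intStirling_nonneg n ((k : ℤ) - 1)
    have h2 : (0 : ℝ) < ((k : ℤ) : ℝ) := by exact_mod_cast hk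
    have := mul_pos h2 ih
    linarith

/-! ### Closed forms of the moments -/

/-- The coefficient of `u ^ K` in the first moment. -/
noncomputable def meanA (n : ℕ) (K : ℤ) : ℝ :=
  (3 / 4 * K - 3 / 4 * K ^ 2 - 1 / 2 * n + 1 / 2 * n * K) * intStirling n K +
    (1 / 2 - 1 / 2 * K + 1 / 2 * n) * intStirling n (K - 1)

/-- Minus the coefficient of `u ^ (K - 1)` in the first moment. -/
noncomputable def meanB (n : ℕ) (K : ℤ) : ℝ :=
  (-1 / 2 * K + 1 / 2 * K ^ 2) * intStirling n K + (-1 + K - n) * intStirling n (K - 1)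

/-- The coefficient of `u ^ K` in the second moment. -/
noncomputable def squareA (n : ℕ) (K : ℤ) : ℝ :=
  (5 / 72 * K + 25 / 48 * K ^ 2 - 83 / 72 * K ^ 3 + 9 / 16 * K ^ 4 - 1 / 12 * n - 3 / 4 * n * K +
      19 / 12 * n * K ^ 2 - 3 / 4 * n * K ^ 3 + 1 / 4 * n ^ 2 - 1 / 2 * n ^ 2 * K +
      1 / 4 * n ^ 2 * K ^ 2) * intStirling n K +
    (-1 / 6 + 5 / 4 * K - 11 / 6 * K ^ 2 + 3 / 4 * K ^ 3 - 13 / 12 * n + 29 / 12 * n * K -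
      5 / 4 * n * K ^ 2 - 3 / 4 * n ^ 2 + 1 / 2 * n ^ 2 * K) * intStirling n (K - 1) +
    (1 / 6 - 7 / 12 * K + 1 / 4 * K ^ 2 + 7 / 12 * n - 1 / 2 * n * K + 1 / 4 * n ^ 2) *
      intStirling n (K - 2)

/-- The coefficient of `u ^ (K - 1)` in the second moment. -/
noncomputable def squareB (n : ℕ) (K : ℤ) : ℝ :=
  (1 / 6 * K + 1 / 4 * K ^ 2 - 7 / 6 * K ^ 3 + 3 / 4 * K ^ 4 - 1 / 2 * n * K + n * K ^ 2 -
      1 / 2 * n * K ^ 3) * intStirling n K +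
    (2 - 4 * K ^ 2 + 2 * K ^ 3 - 2 * n + 6 * n * K - 3 * n * K ^ 2 - 2 * n ^ 2 + n ^ 2 * K) *
      intStirling n (K - 1) +
    (-2 - K + K ^ 2 + n - 2 * n * K + n ^ 2) * intStirling n (K - 2)

/-- The coefficient of `u ^ (K - 2)` in the second moment. -/
noncomputable def squareC (n : ℕ) (K : ℤ) : ℝ :=
  (-1 / 6 * K + 3 / 4 * K ^ 2 - 5 / 6 * K ^ 3 + 1 / 4 * K ^ 4) * intStirling n K +
    (-2 + 5 * K - 4 * K ^ 2 + K ^ 3 - 2 * n + 3 * n * K - n * K ^ 2) * intStirling n (K - 1) +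
    (2 - 3 * K + K ^ 2 + 3 * n - 2 * n * K + n ^ 2) * intStirling n (K - 2)

lemma meanA_succ (n : ℕ) (K : ℤ) : meanA (n + 1) K =
    meanA n (K - 1) + K * meanA n K + K * (K - 1) / 2 * intStirling n K := by
  simp only [meanA, intStirling_succ, show K - 1 - 1 = K - 2 by ring]
  push_cast
  ring

lemma meanB_succ (n : ℕ) (K : ℤ) : meanB (n + 1) K =
    meanB n (K - 1) + (K - 1) * meanB n K + K * (K - 1) / 2 * intStirling n K := by
  simp only [meanB, intStirling_succ, show K - 1 - 1 = K - 2 by ring]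
  push_cast
  ring

lemma squareA_succ (n : ℕ) (K : ℤ) : squareA (n + 1) K =
    squareA n (K - 1) + K * squareA n K + K * (K - 1) * meanA n K +
      (K * (K - 1) * (K - 2) / 3 + K * (K - 1) / 2) * intStirling n K := by
  simp only [squareA, meanA, intStirling_succ, show K - 1 - 1 = K - 2 by ring,
    show K - 1 - 2 = K - 3 by ring, show K - 2 - 1 = K - 3 by ring]
  push_cast
  ring

lemma squareB_succ (n : ℕ) (K : ℤ) : squareB (n + 1) K =
    squareB n (K - 1) + (K - 1) * squareB n K - K * (K - 1) * meanA n K -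
      (K - 1) * (K - 2) * meanB n K -
      (2 * (K * (K - 1) * (K - 2)) / 3 + K * (K - 1) / 2) * intStirling n K := by
  simp only [squareB, meanA, meanB, intStirling_succ, show K - 1 - 1 = K - 2 by ring,
    show K - 1 - 2 = K - 3 by ring, show K - 2 - 1 = K - 3 by ring]
  push_cast
  ring

lemma squareC_succ (n : ℕ) (K : ℤ) : squareC (n + 1) K =
    squareC n (K - 1) + (K - 2) * squareC n K + (K - 1) * (K - 2) * meanB n K +
      K * (K - 1) * (K - 2) / 3 * intStirling n K := by
  simp only [squareC, meanB, intStirling_succ, show K - 1 - 1 = K - 2 by ring,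
    show K - 1 - 2 = K - 3 by ring, show K - 2 - 1 = K - 3 by ring]
  push_cast
  ring

lemma meanA_of_neg (n : ℕ) {K : ℤ} (hK : K < 0) : meanA n K = 0 := by
  simp [meanA, intStirling_of_neg n K hK, intStirling_of_neg n (K - 1) (by omega)]

lemma squareA_of_neg (n : ℕ) {K : ℤ} (hK : K < 0) : squareA n K = 0 := by
  simp [squareA, intStirling_of_neg n K hK, intStirling_of_neg n (K - 1) (by omega),
    intStirling_of_neg n (K - 2) (by omega)]

lemma meanB_of_nonpos (n : ℕ) {K : ℤ} (hK : K ≤ 0) : meanB n K = 0 := by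
  rcases hK.lt_or_eq with hK | rfl
  · simp [meanB, intStirling_of_neg n K hK, intStirling_of_neg n (K - 1) (by omega)]
  · simp [meanB, intStirling_of_neg n]

lemma squareB_of_nonpos (n : ℕ) {K : ℤ} (hK : K ≤ 0) : squareB n K = 0 := by
  rcases hK.lt_or_eq with hK | rfl
  · simp [squareB, intStirling_of_neg n K hK, intStirling_of_neg n (K - 1) (by omega),
      intStirling_of_neg n (K - 2) (by omega)]
  · simp [squareB, intStirling_of_neg n]

lemma squareC_of_le_one (n : ℕ) {K : ℤ} (hK : K ≤ 1) : squareC n K = 0 := by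
  rcases lt_trichotomy K 0 with hK | rfl | hK'
  · simp [squareC, intStirling_of_neg n K hK, intStirling_of_neg n (K - 1) (by omega),
      intStirling_of_neg n (K - 2) (by omega)]
  · simp [squareC, intStirling_of_neg n]
  · obtain rfl : K = 1 := by omega
    simp only [squareC, intStirling_of_neg n (1 - 2) (by omega)]
    push_cast
    ring

lemma intStirling_zero_eq_zero {K : ℤ} (hK : K ≠ 0) : intStirling 0 K = 0 := if_neg hK

lemma mean_square_zero (K : ℤ) : meanA 0 K = 0 ∧ meanB 0 K = 0 ∧ squareA 0 K = 0 ∧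
    squareB 0 K = 0 ∧ squareC 0 K = 0 := by
  by_cases h0 : K = 0
  · subst h0
    norm_num [meanA, meanB, squareA, squareB, squareC, intStirling]
  by_cases h1 : K = 1
  · subst h1
    norm_num [meanA, meanB, squareA, squareB, squareC, intStirling]
  by_cases h2 : K = 2
  · subst h2
    norm_num [meanA, meanB, squareA, squareB, squareC, intStirling]
  · simp [meanA, meanB, squareA, squareB, squareC, intStirling_zero_eq_zero h0,
      intStirling_zero_eq_zero (sub_ne_zero.2 h1), intStirling_zero_eq_zero (sub_ne_zero.2 h2)]

lemma mul_intChoose_pascal (x : ℝ) (K H : ℤ) (hx : K ≤ 0 → x = 0) :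
    x * (intChoose (K - 1) H + intChoose (K - 1) (H - 1)) = x * intChoose K H := by
  rcases le_or_gt K 0 with hK | hK
  · simp [hx hK]
  · rw [intChoose_pascal hK]

lemma openMoment_zero_eq (n : ℕ) (K H : ℤ) :
    openMoment n K H 0 = intStirling n K * intChoose K H := by
  induction n generalizing K H with
  | zero =>
    rw [openMoment_zero_left, intStirling]
    by_cases hK : K = 0
    · subst hK
      simp [intChoose_zero_left]
    · simp [hK]
  | succ n ih =>
    rw [openMoment_zero_succ, ih, ih, ih, ih, intStirling_succ]
    linear_combination intStirling n K * intChoose_deriv K H +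
      mul_intChoose_pascal (intStirling n (K - 1)) K H
        fun h => intStirling_of_neg n _ (by omega)

lemma openMoment_one_eq (n : ℕ) (K H : ℤ) :
    openMoment n K H 1 = meanA n K * intChoose K H - meanB n K * intChoose (K - 1) H := by
  induction n generalizing K H with
  | zero => simp [openMoment_zero_left, mean_square_zero K]
  | succ n ih =>
    have e := intChoose_deriv (K - 1) H
    have p := mul_intChoose_pascal (meanB n (K - 1)) (K - 1) H
      fun h => meanB_of_nonpos n (by omega)
    push_cast at e
    rw [openMoment_one_succ, ih, ih, ih, ih, openMoment_zero_eq, openMoment_zero_eq, meanA_succ,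
      meanB_succ]
    linear_combination meanA n K * intChoose_deriv K H - meanB n K * e +
      intStirling n K / 2 * intChoose_deriv_two K H +
      mul_intChoose_pascal (meanA n (K - 1)) K H (fun h => meanA_of_neg n (by omega)) - p

lemma openMoment_two_eq (n : ℕ) (K H : ℤ) :
    openMoment n K H 2 = squareA n K * intChoose K H + squareB n K * intChoose (K - 1) H +
      squareC n K * intChoose (K - 2) H := by
  induction n generalizing K H with
  | zero => simp [openMoment_zero_left, mean_square_zero K]
  | succ n ih =>
    have e1 := intChoose_deriv (K - 1) H
    have e2 := intChoose_deriv (K - 2) H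
    have e3 := intChoose_deriv_two (K - 1) H
    have p1 := mul_intChoose_pascal (squareA n (K - 1)) K H
      fun h => squareA_of_neg n (by omega)
    have p2 := mul_intChoose_pascal (squareB n (K - 1)) (K - 1) H
      fun h => squareB_of_nonpos n (by omega)
    have p3 := mul_intChoose_pascal (squareC n (K - 1)) (K - 2) H
      fun h => squareC_of_le_one n (by omega)
    rw [openMoment_two_succ, ih, ih, ih, ih, openMoment_one_eq, openMoment_one_eq,
      openMoment_zero_eq, openMoment_zero_eq, squareA_succ, squareB_succ, squareC_succ]
    simp only [show K - 1 - 1 = K - 2 by ring, show K - 1 - 2 = K - 3 by ring,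
      show K - 2 - 1 = K - 3 by ring] at *
    push_cast at e1 e2 e3
    linear_combination squareA n K * intChoose_deriv K H + squareB n K * e1 + squareC n K * e2 +
      meanA n K * intChoose_deriv_two K H - meanB n K * e3 +
      intStirling n K / 3 * intChoose_deriv_three K H +
      intStirling n K / 2 * intChoose_deriv_two K H + p1 + p2 + p3

/-! ### The arc diagram of a set partition -/

section Diagram

variable {n : ℕ} (π : Finpartition (univ : Finset (Fin n)))

open Relation

lemma sameBlock_iff_part_eq {a b : Fin n} : sameBlock π a b ↔ π.part a = π.part b := by
  constructor
  · rintro ⟨B, hB, ha, hb⟩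
    rw [π.part_eq_of_mem hB ha, π.part_eq_of_mem hB hb]
  · intro h
    refine ⟨π.part a, π.part_mem.2 (mem_univ a), π.mem_part (mem_univ a), ?_⟩
    rw [h]
    exact π.mem_part (mem_univ b)

open Classical in
/-- The set of arcs of a set partition, as pairs of natural numbers. -/
noncomputable def diagram : Finset (ℕ × ℕ) :=
  ({p | IsArc π p.1 p.2} : Finset (Fin n × Fin n)).map
    (Fin.valEmbedding.prodMap Fin.valEmbedding)

lemma mem_diagram {p : ℕ × ℕ} :
    p ∈ diagram π ↔ ∃ a b : Fin n, IsArc π a b ∧ p = (a.val, b.val) := by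
  simp only [diagram, mem_map, mem_filter, mem_univ, true_and, Prod.exists]
  constructor <;> rintro ⟨a, b, h, e⟩ <;> exact ⟨a, b, h, e.symm⟩

lemma mk_mem_diagram {a b : Fin n} : (a.val, b.val) ∈ diagram π ↔ IsArc π a b := by
  rw [mem_diagram]
  constructor
  · rintro ⟨a', b', h, e⟩
    rw [Prod.mk.injEq] at e
    rwa [Fin.ext e.1, Fin.ext e.2]
  · exact fun h => ⟨a, b, h, rfl⟩

variable {π} in
lemma IsArc.right_unique {a b c : Fin n} (h : IsArc π a b) (h' : IsArc π a c) : b = c := by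
  rcases lt_trichotomy b c with hbc | rfl | hbc
  · exact absurd h.2.1 (h'.2.2 b h.1 hbc)
  · rfl
  · exact absurd h'.2.1 (h.2.2 c h'.1 hbc)

variable {π} in
lemma IsArc.left_unique {a b c : Fin n} (h : IsArc π a c) (h' : IsArc π b c) : a = b := by
  have e : sameBlock π a b := by
    have h1 := h.2.1
    have h2 := h'.2.1
    rw [sameBlock_iff_part_eq] at *
    rw [h1, h2]
  have e' : sameBlock π b a := by
    rw [sameBlock_iff_part_eq] at *
    exact e.symm
  rcases lt_trichotomy a b with hab | rfl | hab
  · exact absurd e (h.2.2 b hab h'.1)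
  · rfl
  · exact absurd e' (h'.2.2 a hab h.1)

lemma isArcDiagram_diagram : IsArcDiagram n (diagram π) := by
  refine ⟨fun p hp => ?_, fun p hp q hq e => ?_, fun p hp q hq e => ?_⟩
  · obtain ⟨a, b, h, rfl⟩ := (mem_diagram π).1 hp
    exact ⟨h.1, b.2⟩
  · obtain ⟨a, b, h, rfl⟩ := (mem_diagram π).1 hp
    obtain ⟨c, d, h', rfl⟩ := (mem_diagram π).1 hq
    obtain rfl : a = c := Fin.ext e
    rw [h.right_unique h']
  · obtain ⟨a, b, h, rfl⟩ := (mem_diagram π).1 hp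
    obtain ⟨c, d, h', rfl⟩ := (mem_diagram π).1 hq
    obtain rfl : b = d := Fin.ext e
    rw [h.left_unique h']

lemma crl_eq_crossings : crl π = crossings (diagram π) := by
  classical
  have h1 : crossings (diagram π) = #(((diagram π) ×ˢ (diagram π)).filter fun q =>
      q.1.1 < q.2.1 ∧ q.2.1 < q.1.2 ∧ q.1.2 < q.2.2) := by
    rw [crossings, card_filter, sum_product_right]
    simp only [card_filter]
  rw [h1, crl, Set.ncard_eq_toFinset_card']
  refine card_bij (fun q _ => ((q.1.1.val, q.1.2.val), (q.2.1.val, q.2.2.val))) ?_ ?_ ?_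
  · intro q hq
    simp only [Set.mem_toFinset, Set.mem_ofPred_eq] at hq
    simp only [mem_filter, mem_product, mk_mem_diagram]
    exact ⟨⟨hq.1, hq.2.1⟩, hq.2.2⟩
  · rintro ⟨⟨a, b⟩, c, d⟩ _ ⟨⟨a', b'⟩, c', d'⟩ _ e
    simp only [Prod.mk.injEq, Fin.val_inj] at e ⊢
    exact e
  · rintro ⟨p, q⟩ h
    simp only [mem_filter, mem_product] at h
    obtain ⟨⟨hp, hq⟩, h2⟩ := h
    obtain ⟨a, b, hab, rfl⟩ := (mem_diagram π).1 hp
    obtain ⟨c, d, hcd, rfl⟩ := (mem_diagram π).1 hq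
    refine ⟨((a, b), (c, d)), ?_, rfl⟩
    simp only [Set.mem_toFinset, Set.mem_ofPred_eq]
    exact ⟨hab, hcd, h2⟩

/-- Every element that is not the least one of its block is the right end of an arc. -/
lemma exists_isArc_of_sameBlock {a b : Fin n} (hab : a < b) (h : sameBlock π a b) :
    ∃ c, a ≤ c ∧ IsArc π c b := by
  classical
  have hne : ({c | c < b ∧ sameBlock π c b} : Finset (Fin n)).Nonempty :=
    ⟨a, by simpa using ⟨hab, h⟩⟩
  have hm := max'_mem _ hne
  have hle := fun c hc => le_max' ({c | c < b ∧ sameBlock π c b} : Finset (Fin n)) c hc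
  simp only [mem_filter, mem_univ, true_and] at hm hle
  refine ⟨_, hle a ⟨hab, h⟩, hm.1, hm.2, fun c hc hcb hs => ?_⟩
  refine (hle c ⟨hcb, ?_⟩).not_gt hc
  rw [sameBlock_iff_part_eq] at *
  exact hs.symm.trans hm.2

lemma card_diagram_add_card_parts : #(diagram π) + #π.parts = n := by
  classical
  have h1 : #(diagram π) = #({b | ∃ a < b, sameBlock π a b} : Finset (Fin n)) := by
    rw [diagram, card_map]
    refine card_bij (fun p _ => p.2) ?_ ?_ ?_
    · intro p hp
      simp only [mem_filter, mem_univ, true_and] at hp ⊢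
      exact ⟨p.1, hp.1, hp.2.1⟩
    · rintro ⟨a, b⟩ h ⟨c, d⟩ h' e
      simp only [mem_filter, mem_univ, true_and] at h h' e
      subst e
      rw [h.left_unique h']
    · intro b hb
      simp only [mem_filter, mem_univ, true_and] at hb
      obtain ⟨a, hab, h⟩ := hb
      obtain ⟨c, _, hc⟩ := exists_isArc_of_sameBlock π hab h
      exact ⟨(c, b), by simpa using hc, rfl⟩
  have h2 : #π.parts = #({b | ¬ ∃ a < b, sameBlock π a b} : Finset (Fin n)) := by
    symm
    refine card_bij (fun b _ => π.part b) ?_ ?_ ?_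
    · exact fun b _ => π.part_mem.2 (mem_univ b)
    · intro b hb c hc e
      simp only [mem_filter, mem_univ, true_and, not_exists, not_and] at hb hc
      rcases lt_trichotomy b c with hbc | rfl | hbc
      · exact absurd ((sameBlock_iff_part_eq π).2 e) (hc b hbc)
      · rfl
      · exact absurd ((sameBlock_iff_part_eq π).2 e.symm) (hb c hbc)
    · intro B hB
      have hne := π.nonempty_of_mem_parts hB
      refine ⟨B.min' hne, ?_, π.part_eq_of_mem hB (min'_mem _ _)⟩
      simp only [mem_filter, mem_univ, true_and, not_exists, not_and]
      intro a ha hs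
      rw [sameBlock_iff_part_eq, π.part_eq_of_mem hB (min'_mem B hne)] at hs
      refine (min'_le B a ?_).not_gt ha
      rw [← hs]
      exact π.mem_part (mem_univ a)
  rw [h1, h2, card_filter_add_card_filter_not, card_univ, Fintype.card_fin]

lemma reflTransGen_isArc_of_sameBlock {a b : Fin n} (hab : a ≤ b) (h : sameBlock π a b) :
    ReflTransGen (IsArc π) a b := by
  induction b using WellFoundedLT.induction with
  | ind b ih =>
    rcases hab.lt_or_eq with hab | rfl
    · obtain ⟨c, hac, hc⟩ := exists_isArc_of_sameBlock π hab h
      refine (ih c hc.1 hac ?_).tail hc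
      have := hc.2.1
      rw [sameBlock_iff_part_eq] at *
      exact h.trans this.symm
    · exact ReflTransGen.refl

lemma sameBlock_of_reflTransGen_isArc {a b : Fin n} (h : ReflTransGen (IsArc π) a b) :
    sameBlock π a b := by
  rw [sameBlock_iff_part_eq]
  induction h with
  | refl => rfl
  | tail _ h ih => exact ih.trans ((sameBlock_iff_part_eq π).1 h.2.1)

lemma sameBlock_iff_reflTransGen {a b : Fin n} :
    sameBlock π a b ↔ ReflTransGen (IsArc π) a b ∨ ReflTransGen (IsArc π) b a := by
  have hsymm : sameBlock π a b ↔ sameBlock π b a := by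
    simp only [sameBlock_iff_part_eq, eq_comm]
  constructor
  · intro h
    rcases le_total a b with hab | hab
    · exact Or.inl (reflTransGen_isArc_of_sameBlock π hab h)
    · exact Or.inr (reflTransGen_isArc_of_sameBlock π hab (hsymm.1 h))
  · rintro (h | h)
    · exact sameBlock_of_reflTransGen_isArc π h
    · exact hsymm.2 (sameBlock_of_reflTransGen_isArc π h)

end Diagram

lemma diagram_injective (n : ℕ) :
    Function.Injective (diagram : Finpartition (univ : Finset (Fin n)) → Finset (ℕ × ℕ)) := by
  intro π σ h
  have harc : IsArc π = IsArc σ := by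
    funext a b
    rw [← mk_mem_diagram, ← mk_mem_diagram, h]
  have hpart : ∀ a, π.part a = σ.part a := by
    intro a
    ext b
    rw [π.mem_part_iff_exists, σ.mem_part_iff_exists]
    have := sameBlock_iff_reflTransGen π (a := b) (b := a)
    rw [harc, ← sameBlock_iff_reflTransGen σ] at this
    exact this
  have hsub : ∀ (π σ : Finpartition (univ : Finset (Fin n))), (∀ a, π.part a = σ.part a) →
      π.parts ⊆ σ.parts := by
    intro π σ hp B hB
    obtain ⟨a, ha⟩ := π.nonempty_of_mem_parts hB
    rw [← π.part_eq_of_mem hB ha, hp a]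
    exact σ.part_mem.2 (mem_univ a)
  exact Finpartition.ext ((hsub π σ hpart).antisymm (hsub σ π fun a => (hpart a).symm))

/-- Every arc diagram is the arc diagram of a set partition, whose blocks are the connected
components. -/
lemma exists_diagram_eq {n : ℕ} {R : Finset (ℕ × ℕ)} (hR : IsArcDiagram n R) :
    ∃ π : Finpartition (univ : Finset (Fin n)), diagram π = R := by
  classical
  let r : Fin n → Fin n → Prop := fun a b => (a.val, b.val) ∈ R
  have hlt : ∀ {a b}, r a b → a < b := fun h => (hR.1 _ h).1
  have hru : ∀ {a b c}, r a b → r a c → b = c := fun h h' =>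
    Fin.ext (congrArg Prod.snd (hR.2.1 _ h _ h' rfl))
  have hlu : ∀ {a b c}, r a c → r b c → a = b := fun h h' =>
    Fin.ext (congrArg Prod.fst (hR.2.2 _ h _ h' rfl))
  have hle : ∀ {a b}, Relation.ReflTransGen r a b → a ≤ b := by
    intro a b h
    induction h with
    | refl => exact le_rfl
    | tail _ h ih => exact ih.trans (hlt h).le
  have htot : ∀ {a b c}, Relation.ReflTransGen r a b → Relation.ReflTransGen r a c →
      Relation.ReflTransGen r b c ∨ Relation.ReflTransGen r c b := fun h h' =>
    Relation.ReflTransGen.total_of_right_unique (fun _ _ _ h h' => hru h h') h h'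
  have htot' : ∀ {a b c}, Relation.ReflTransGen r b a → Relation.ReflTransGen r c a →
      Relation.ReflTransGen r b c ∨ Relation.ReflTransGen r c b := by
    intro a b c h h'
    have h1 := Relation.reflTransGen_swap.2 h
    have h2 := Relation.reflTransGen_swap.2 h'
    have hsw : Relator.RightUnique (Function.swap r) := fun _ _ _ h h' => hlu h h'
    exact ((Relation.ReflTransGen.total_of_right_unique hsw h1 h2).imp
      Relation.reflTransGen_swap.1 Relation.reflTransGen_swap.1).symm
  let s : Setoid (Fin n) :=
    { r := fun a b => Relation.ReflTransGen r a b ∨ Relation.ReflTransGen r b a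
      iseqv :=
        { refl := fun _ => Or.inl .refl
          symm := fun h => h.symm
          trans := by
            rintro a b c (h | h) (h' | h')
            · exact Or.inl (h.trans h')
            · exact htot' h h'
            · exact htot h h'
            · exact Or.inr (h'.trans h) } }
  let π : Finpartition (univ : Finset (Fin n)) := Finpartition.ofSetoid s
  have hs : ∀ a b, sameBlock π a b ↔
      (Relation.ReflTransGen r a b ∨ Relation.ReflTransGen r b a) := by
    intro a b
    have h1 : b ∈ π.part a ↔ s a b := Finpartition.mem_part_ofSetoid_iff_rel
    have h2 : b ∈ π.part a ↔ sameBlock π b a := π.mem_part_iff_exists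
    have h3 : sameBlock π a b ↔ sameBlock π b a := by
      simp only [sameBlock_iff_part_eq, eq_comm]
    rw [h3, ← h2, h1]
    rfl
  have harc : ∀ a b, IsArc π a b ↔ r a b := by
    intro a b
    constructor
    · rintro ⟨hab, h, hmin⟩
      rcases (hs a b).1 h with h | h
      · rcases Relation.ReflTransGen.cases_head h with rfl | ⟨c, hac, hcb⟩
        · exact absurd hab (lt_irrefl _)
        · rcases (hle hcb).lt_or_eq with hlt' | rfl
          · exact absurd ((hs a c).2 (Or.inl (.single hac))) (hmin c (hlt hac) hlt')
          · exact hac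
      · exact absurd hab (hle h).not_gt
    · intro h
      refine ⟨hlt h, (hs a b).2 (Or.inl (.single h)), fun c hac hcb hc => ?_⟩
      rcases (hs a c).1 hc with hc | hc
      · rcases Relation.ReflTransGen.cases_head hc with rfl | ⟨d, had, hdc⟩
        · exact lt_irrefl _ hac
        · rw [← hru h had] at hdc
          exact (hle hdc).not_gt hcb
      · exact (hle hc).not_gt hac
  refine ⟨π, ?_⟩
  ext ⟨a, b⟩
  rw [mem_diagram]
  constructor
  · rintro ⟨a, b, h, e⟩
    rw [e]
    exact (harc a b).1 h
  · intro h
    have h1 := hR.1 _ h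
    exact ⟨⟨a, h1.1.trans h1.2⟩, ⟨b, h1.2⟩, (harc _ _).2 h, rfl⟩

lemma sum_crl_pow (n k j : ℕ) :
    ∑ π ∈ Pik n k, (crl π : ℝ) ^ j = openMoment n k 0 j := by
  classical
  have h1 : openMoment n k 0 j =
      ∑ R ∈ arcDiagrams n, if (n : ℤ) - #R = k then (crossings R : ℝ) ^ j else 0 := by
    rw [openMoment, openSum]
    refine sum_congr rfl fun R _ => ?_
    rw [sum_eq_single ∅]
    · simp [blockPow, openCrossings]
    · intro O _ hO
      rw [blockPow, if_neg]
      rintro ⟨_, h⟩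
      exact hO (card_eq_zero.1 (by exact_mod_cast h))
    · exact fun h => absurd (empty_mem_powerset _) h
  rw [h1, ← sum_filter, Pik]
  refine sum_bij (fun π _ => diagram π) ?_ ?_ ?_ ?_
  · intro π hπ
    have h2 := card_diagram_add_card_parts π
    simp only [mem_filter, mem_univ, true_and] at hπ
    simp only [mem_filter, mem_arcDiagrams]
    exact ⟨isArcDiagram_diagram π, by omega⟩
  · exact fun π _ σ _ h => diagram_injective n h
  · intro R hR
    simp only [mem_filter, mem_arcDiagrams] at hR
    obtain ⟨π, rfl⟩ := exists_diagram_eq hR.1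
    have h2 := card_diagram_add_card_parts π
    refine ⟨π, ?_, rfl⟩
    simp only [mem_filter, mem_univ, true_and]
    omega
  · exact fun π _ => by rw [crl_eq_crossings]

lemma stirling_eq_intStirling (n k : ℕ) : (stirling n k : ℝ) = intStirling n k := by
  have h1 : (stirling n k : ℝ) = ∑ π ∈ Pik n k, (crl π : ℝ) ^ 0 := by
    rw [stirling, Nat.card_eq_fintype_card, Fintype.card_subtype, Pik]
    simp
  rw [h1, sum_crl_pow, openMoment_zero_eq, intChoose_zero_right (by omega), mul_one]

/-- Theorem: exact formula for the variance of the linear crossing number on `Π_n^k`. -/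
theorem var_crl_blocks (n k : ℕ) (hk : 1 ≤ k) (hkn : k ≤ n) :
    VarX n k = (1 / 12 : ℝ) * ((k : ℝ) ^ 2 - 1) * (n : ℝ)
        - (1 / 72 : ℝ) * (k : ℝ) * ((k : ℝ) - 1) * (2 * (k : ℝ) + 5)
        + (1 / 12 : ℝ) * (-15 * (n : ℝ) ^ 2 + (56 * (k : ℝ) - 43) * (n : ℝ)
            - 2 * ((k : ℝ) - 1) * (14 * (k : ℝ) - 1)) *
          ((stirling n (k - 1) : ℝ) / (stirling n k : ℝ))
        + (1 / 12 : ℝ) * ((n : ℝ) - (k : ℝ) + 2) * (27 * (n : ℝ) - 27 * (k : ℝ) + 1) *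
          ((stirling n (k - 2) : ℝ) / (stirling n k : ℝ))
        - (9 / 4 : ℝ) * ((n : ℝ) + 1 - (k : ℝ)) ^ 2 *
          ((stirling n (k - 1) : ℝ) / (stirling n k : ℝ)) ^ 2 := by
  have hpos := intStirling_pos hk hkn
  have hne := hpos.ne'
  have e1 : (stirling n (k - 1) : ℝ) = intStirling n ((k : ℤ) - 1) := by
    rw [stirling_eq_intStirling, Nat.cast_sub hk, Nat.cast_one]
  have hzero : intStirling n 0 = 0 := by
    obtain ⟨m, rfl⟩ : ∃ m, n = m + 1 := ⟨n - 1, by omega⟩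
    rw [intStirling_succ, intStirling_of_neg m (0 - 1) (by omega)]
    simp
  have e2 : (stirling n (k - 2) : ℝ) = intStirling n ((k : ℤ) - 2) := by
    rw [stirling_eq_intStirling]
    rcases hk.lt_or_eq with h | rfl
    · rw [Nat.cast_sub (show 2 ≤ k from h), Nat.cast_ofNat]
    · rw [intStirling_of_neg n (((1 : ℕ) : ℤ) - 2) (by omega)]
      exact hzero
  have m1 : ∑ π ∈ Pik n k, (crl π : ℝ) = meanA n k - meanB n k := by
    have h := sum_crl_pow n k 1
    simp only [pow_one] at h
    rw [h, openMoment_one_eq, intChoose_zero_right (by omega), intChoose_zero_right (by omega)]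
    ring
  have m2 : ∑ π ∈ Pik n k, (crl π : ℝ) ^ 2 = squareA n k + squareB n k + squareC n k := by
    rw [sum_crl_pow, openMoment_two_eq]
    rcases hk.lt_or_eq with h | rfl
    · rw [intChoose_zero_right (by omega), intChoose_zero_right (by omega),
        intChoose_zero_right (by omega)]
      ring
    · rw [intChoose_zero_right (by omega), intChoose_zero_right (by omega),
        squareC_of_le_one n (by norm_num)]
      ring
  rw [VarX, EX, m1, m2, e1, e2, stirling_eq_intStirling, meanA, meanB, squareA, squareB, squareC]
  push_cast
  field_simp
  ring
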